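/- The polynomial f = x¹² + x¹¹ + 2x² + 2x + 1 ∈ F_3[x] is square-free, and the number of pairs (x, y) ∈ F_3 × F_3 satisfying y² = f(x) is exactly 6. (Hence the genus-five hyperelliptic curve y² = f(x) over F_3 has exactly 8 F_3-rational points, the maximal possible number.) -/

import Mathlib

open Polynomial

/-- The genus-five hyperelliptic curve `y² = x¹² + x¹¹ + 2x² + 2x + 1` over `F₃`
has `6` affine `F₃`-points (hence `8` `F₃`-rational points, the maximum). -/
theorem hyperelliptic_example3_F3_affine_points :
    Squarefree ((X : Polynomial (ZMod 3)) ^ 12 + X ^ 11 + C 2 * X ^ 2 + C 2 * X + 1) ∧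
    Nat.card {p : ZMod 3 × ZMod 3 //
      p.2 ^ 2 = Polynomial.eval p.1
        ((X : Polynomial (ZMod 3)) ^ 12 + X ^ 11 + C 2 * X ^ 2 + C 2 * X + 1)} = 6 := by
  have h3 : (3 : Polynomial (ZMod 3)) = 0 := by
    have h : (C (3 : ZMod 3) : Polynomial (ZMod 3)) = 0 := by
      rw [show (3 : ZMod 3) = 0 from rfl, C_0]
    simpa only [map_ofNat] using h
  constructor
  · apply Polynomial.Separable.squarefree
    rw [Polynomial.separable_def]
    have hd : derivative ((X : Polynomial (ZMod 3)) ^ 12 + X ^ 11 + C 2 * X ^ 2 + C 2 * X + 1)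
        = 12 * X ^ 11 + 11 * X ^ 10 + 4 * X + 2 := by
      simp only [derivative_add, derivative_X_pow, derivative_C_mul, derivative_X,
        derivative_one]
      simp only [map_natCast, map_ofNat]
      push_cast
      ring
    rw [hd]
    refine ⟨1 * X ^ 0 + 2 * X ^ 2 + 1 * X ^ 3 + 1 * X ^ 4 + 1 * X ^ 5 + 2 * X ^ 6 + 1 * X ^ 7 + 2 * X ^ 9, 2 * X ^ 1 + 2 * X ^ 3 + 2 * X ^ 5 + 2 * X ^ 6 + 1 * X ^ 9 + 2 * X ^ 10 + 2 * X ^ 11, ?_⟩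
    simp only [map_ofNat]
    linear_combination (2 * X ^ 1 + 4 * X ^ 2 + 3 * X ^ 3 + 5 * X ^ 4 + 3 * X ^ 5 + 6 * X ^ 6 + 5 * X ^ 7 + 2 * X ^ 8 + 2 * X ^ 9 + 4 * X ^ 10 + 13 * X ^ 11 + 11 * X ^ 12 + 8 * X ^ 13 + 9 * X ^ 14 + 8 * X ^ 15 + 16 * X ^ 16 + 9 * X ^ 17 + 1 * X ^ 18 + 4 * X ^ 19 + 12 * X ^ 20 + 16 * X ^ 21 + 8 * X ^ 22) * h3
  · simp only [eval_add, eval_mul, eval_pow, eval_X, eval_C, eval_one]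
    rw [Nat.card_eq_fintype_card]
    decide
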